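/- For p ∈ (0, ∞), the intermediate energy of E_{π/2} is finite if and only if p ∈ (0, 2); that is, I_p(E_{π/2}) < ∞ ⟺ 0 < p < 2. -/

import Mathlib

open MeasureTheory Real
open scoped ENNReal NNReal Classical

/-- The Menger curvature of three points in `ℝⁿ`: the reciprocal of the circumradius,
`κ(x,y,z) = 2 dist(z, L_{x,y}) / (|x-z| |y-z|)` for pairwise distinct non-collinear points,
and `0` otherwise. -/
noncomputable def menger {n : ℕ} (x y z : EuclideanSpace ℝ (Fin n)) : ℝ :=
  if x ≠ y ∧ y ≠ z ∧ x ≠ z ∧ ¬ Collinear ℝ ({x, y, z} : Set (EuclideanSpace ℝ (Fin n)))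
  then 2 * Metric.infDist z (affineSpan ℝ ({x, y} : Set (EuclideanSpace ℝ (Fin n))) :
      Set (EuclideanSpace ℝ (Fin n))) / (dist x z * dist y z)
  else 0

/-- The point `(a, b) ∈ ℝ²` (with the Euclidean metric). -/
noncomputable def pt (a b : ℝ) : EuclideanSpace ℝ (Fin 2) :=
  (WithLp.equiv 2 (Fin 2 → ℝ)).symm ![a, b]

/-- The one-corner set `E_φ = ([0,1) × {0}) ∪ [0,1)·(cos φ, sin φ)`. -/
noncomputable def Eset (φ : ℝ) : Set (EuclideanSpace ℝ (Fin 2)) :=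
  {x | ∃ t ∈ Set.Ico (0:ℝ) 1, x = pt t 0} ∪
    {x | ∃ t ∈ Set.Ico (0:ℝ) 1, x = t • pt (Real.cos φ) (Real.sin φ)}

/-- Integral Menger curvature `M_p(X)` (innermost integration in `x`). -/
noncomputable def Mp (p : ℝ) (X : Set (EuclideanSpace ℝ (Fin 2))) : ℝ≥0∞ :=
  ∫⁻ z in X, ∫⁻ y in X, ∫⁻ x in X,
    (ENNReal.ofReal (menger x y z)) ^ p ∂μH[1] ∂μH[1] ∂μH[1]

/-- Intermediate energy `I_p(X)`. -/
noncomputable def Ip (p : ℝ) (X : Set (EuclideanSpace ℝ (Fin 2))) : ℝ≥0∞ :=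
  ∫⁻ y in X, ∫⁻ x in X,
    (⨆ z ∈ X, ENNReal.ofReal (menger x y z)) ^ p ∂μH[1] ∂μH[1]

/-- Global curvature energy `U_p(X)`. -/
noncomputable def Up (p : ℝ) (X : Set (EuclideanSpace ℝ (Fin 2))) : ℝ≥0∞ :=
  ∫⁻ x in X, (⨆ y ∈ X, ⨆ z ∈ X, ENNReal.ofReal (menger x y z)) ^ p ∂μH[1]

theorem pt_apply_zero (a b : ℝ) : pt a b 0 = a := by simp [pt]

theorem pt_apply_one (a b : ℝ) : pt a b 1 = b := by simp [pt]

theorem dist_plane_eq (x y : EuclideanSpace ℝ (Fin 2)) :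
    dist x y = √((x 0 - y 0) ^ 2 + (x 1 - y 1) ^ 2) := by
  rw [EuclideanSpace.dist_eq, Fin.sum_univ_two, Real.dist_eq, Real.dist_eq, sq_abs, sq_abs]

theorem isometry_pt_left : Isometry (fun t : ℝ => pt t 0) :=
  Isometry.of_dist_eq fun s t => by
    simp [dist_plane_eq, pt_apply_zero, pt_apply_one, Real.sqrt_sq_eq_abs, Real.dist_eq]

theorem isometry_pt_right : Isometry (fun t : ℝ => pt 0 t) :=
  Isometry.of_dist_eq fun s t => by
    simp [dist_plane_eq, pt_apply_zero, pt_apply_one, Real.sqrt_sq_eq_abs, Real.dist_eq]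

theorem norm_pt_left {t : ℝ} (ht : 0 ≤ t) : ‖pt t 0‖ = t := by
  simp [EuclideanSpace.norm_eq, Fin.sum_univ_two, pt_apply_zero, pt_apply_one, Real.sqrt_sq ht]

theorem norm_pt_right {t : ℝ} (ht : 0 ≤ t) : ‖pt 0 t‖ = t := by
  simp [EuclideanSpace.norm_eq, Fin.sum_univ_two, pt_apply_zero, pt_apply_one, Real.sqrt_sq ht]

theorem Eset_pi_div_two :
    Eset (π / 2) = (fun t : ℝ => pt t 0) '' Set.Ico 0 1 ∪ (fun t : ℝ => pt 0 t) '' Set.Ico 0 1 := by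
  have h (t : ℝ) : t • pt 0 1 = pt 0 t := by
    ext i; fin_cases i <;> simp [pt]
  ext x
  simp [Eset, h, eq_comm]

theorem measurableSet_Eset_pi_div_two : MeasurableSet (Eset (π / 2)) := by
  rw [Eset_pi_div_two]
  exact (isometry_pt_left.isClosedEmbedding.measurableEmbedding.measurableSet_image.2
    measurableSet_Ico).union
    (isometry_pt_right.isClosedEmbedding.measurableEmbedding.measurableSet_image.2
      measurableSet_Ico)

theorem Isometry.setLIntegral_image_hausdorffMeasure {E : Type*} [MetricSpace E]
    [MeasurableSpace E] [BorelSpace E] {f : ℝ → E} (hf : Isometry f) {s : Set ℝ}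
    (hs : MeasurableSet s) (g : E → ℝ≥0∞) :
    ∫⁻ x in f '' s, g x ∂μH[1] = ∫⁻ t in s, g (f t) := by
  have he : MeasurableEmbedding f := hf.isClosedEmbedding.measurableEmbedding
  have h : (μH[1] : Measure E).restrict (f '' s) =
      ((volume : Measure ℝ).restrict s).map f := by
    rw [← hausdorffMeasure_real, ← Set.preimage_image_eq s hf.injective, ← he.restrict_map,
      hf.map_hausdorffMeasure (Or.inl zero_le_one),
      Measure.restrict_restrict (he.measurableSet_image.2 hs), Set.preimage_image_eq s hf.injective,
      Set.inter_eq_left.2 (Set.image_subset_range f s)]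
  rw [h, he.lintegral_map]

/-- The distance from a point to a line in the plane is at most the absolute value of the
determinant over the length of the direction vector. -/
theorem infDist_line_mul_dist_le (x y z : EuclideanSpace ℝ (Fin 2)) (hxy : x ≠ y) :
    Metric.infDist z (affineSpan ℝ ({x, y} : Set (EuclideanSpace ℝ (Fin 2))) :
      Set (EuclideanSpace ℝ (Fin 2))) * dist x y ≤
      |(y 0 - x 0) * (z 1 - x 1) - (y 1 - x 1) * (z 0 - x 0)| := by
  have hd : 0 < dist x y := dist_pos.2 hxy
  have hn : 0 < (x 0 - y 0) ^ 2 + (x 1 - y 1) ^ 2 := by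
    rw [dist_plane_eq] at hd
    exact Real.sqrt_pos.1 hd
  set c : ℝ := ((z 0 - x 0) * (y 0 - x 0) + (z 1 - x 1) * (y 1 - x 1)) /
    ((x 0 - y 0) ^ 2 + (x 1 - y 1) ^ 2) with hc
  have hw : AffineMap.lineMap x y c ∈ affineSpan ℝ ({x, y} : Set (EuclideanSpace ℝ (Fin 2))) :=
    AffineMap.lineMap_mem_affineSpan_pair c x y
  have h0 (i : Fin 2) : (AffineMap.lineMap x y c : EuclideanSpace ℝ (Fin 2)) i =
      x i + c * (y i - x i) := by
    simp [AffineMap.lineMap_apply, add_comm]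
  refine (mul_le_mul_of_nonneg_right (Metric.infDist_le_dist_of_mem hw) hd.le).trans ?_
  rw [dist_plane_eq, dist_plane_eq, h0, h0, ← Real.sqrt_mul (by positivity),
    ← Real.sqrt_sq_eq_abs]
  apply Real.sqrt_le_sqrt
  have hcm : c * ((x 0 - y 0) ^ 2 + (x 1 - y 1) ^ 2) =
      (z 0 - x 0) * (y 0 - x 0) + (z 1 - x 1) * (y 1 - x 1) := by
    rw [hc]; field_simp
  apply le_of_eq
  linear_combination (c * ((x 0 - y 0) ^ 2 + (x 1 - y 1) ^ 2) -
    ((z 0 - x 0) * (y 0 - x 0) + (z 1 - x 1) * (y 1 - x 1))) * hcm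

theorem det_sq_mul_le_of_same_axis {s t : ℝ} (u : ℝ) :
    ((s - t) * u) ^ 2 * (s * t) ≤ (s - t) ^ 2 * (s ^ 2 + u ^ 2) * (t ^ 2 + u ^ 2) := by
  have h : u ^ 2 * (s * t) ≤ (s ^ 2 + u ^ 2) * (t ^ 2 + u ^ 2) := by
    nlinarith [sq_nonneg (s - t), sq_nonneg (s * t), sq_nonneg (u ^ 2), sq_nonneg u,
      mul_nonneg (sq_nonneg u) (sq_nonneg (s - t)), mul_nonneg (sq_nonneg u) (sq_nonneg (s + t)),
      sq_nonneg (s * u), sq_nonneg (t * u)]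
  nlinarith [mul_le_mul_of_nonneg_left h (sq_nonneg (s - t))]

theorem det_sq_mul_le_of_diff_axis {s t : ℝ} (u : ℝ) :
    ((s - u) * t) ^ 2 * (s * t) ≤ (s ^ 2 + t ^ 2) * (s - u) ^ 2 * (t ^ 2 + u ^ 2) := by
  have h : t ^ 2 * (s * t) ≤ (s ^ 2 + t ^ 2) * (t ^ 2 + u ^ 2) := by
    have h1 : s * t ≤ s ^ 2 + t ^ 2 := by nlinarith [sq_nonneg (s - t), sq_nonneg (s + t)]
    nlinarith [mul_le_mul_of_nonneg_left h1 (sq_nonneg t), sq_nonneg (s * u), sq_nonneg (t * u)]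
  nlinarith [mul_le_mul_of_nonneg_left h (sq_nonneg (s - u))]

theorem det_sq_mul_norm_le {x y z : EuclideanSpace ℝ (Fin 2)} (hx : x ∈ Eset (π / 2))
    (hy : y ∈ Eset (π / 2)) (hz : z ∈ Eset (π / 2)) :
    ((y 0 - x 0) * (z 1 - x 1) - (y 1 - x 1) * (z 0 - x 0)) ^ 2 * (‖x‖ * ‖y‖) ≤
      dist x y ^ 2 * dist x z ^ 2 * dist y z ^ 2 := by
  simp only [dist_plane_eq]
  rw [Real.sq_sqrt (by positivity), Real.sq_sqrt (by positivity), Real.sq_sqrt (by positivity)]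
  rw [Eset_pi_div_two] at hx hy hz
  rcases hx with ⟨s, hs, rfl⟩ | ⟨s, hs, rfl⟩ <;> rcases hy with ⟨t, ht, rfl⟩ | ⟨t, ht, rfl⟩ <;>
    rcases hz with ⟨u, hu, rfl⟩ | ⟨u, hu, rfl⟩ <;>
    simp only [pt_apply_zero, pt_apply_one, norm_pt_left hs.1, norm_pt_right hs.1,
      norm_pt_left ht.1, norm_pt_right ht.1]
  · rw [show ((t - s) * (0 - 0) - (0 - 0) * (u - s)) ^ 2 * (s * t) = 0 by ring]
    positivity
  · linarith [det_sq_mul_le_of_same_axis (s := s) (t := t) u]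
  · linarith [det_sq_mul_le_of_diff_axis (s := s) (t := t) u]
  · linarith [det_sq_mul_le_of_diff_axis (s := t) (t := s) u]
  · linarith [det_sq_mul_le_of_diff_axis (s := t) (t := s) u]
  · linarith [det_sq_mul_le_of_diff_axis (s := s) (t := t) u]
  · linarith [det_sq_mul_le_of_same_axis (s := s) (t := t) u]
  · rw [show ((0 - 0) * (u - s) - (t - s) * (0 - 0)) ^ 2 * (s * t) = 0 by ring]
    positivity

theorem menger_le_of_mem_Eset {x y z : EuclideanSpace ℝ (Fin 2)} (hx : x ∈ Eset (π / 2))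
    (hy : y ∈ Eset (π / 2)) (hz : z ∈ Eset (π / 2)) (hx0 : x ≠ 0) (hy0 : y ≠ 0) :
    menger x y z ≤ 2 / √(‖x‖ * ‖y‖) := by
  have hxy0 : 0 < ‖x‖ * ‖y‖ := mul_pos (norm_pos_iff.2 hx0) (norm_pos_iff.2 hy0)
  unfold menger
  split_ifs with h
  · obtain ⟨hxy, hyz, hxz, -⟩ := h
    have hd := infDist_line_mul_dist_le x y z hxy
    have hk := Real.sqrt_le_sqrt (det_sq_mul_norm_le hx hy hz)
    rw [Real.sqrt_mul (sq_nonneg _), Real.sqrt_sq_eq_abs, ← mul_pow, ← mul_pow,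
      Real.sqrt_sq (by positivity)] at hk
    have h1 := dist_pos.2 hxy
    have h2 := dist_pos.2 hyz
    have h3 := dist_pos.2 hxz
    rw [div_le_div_iff₀ (by positivity) (Real.sqrt_pos.2 hxy0)]
    have h4 := (mul_le_mul_of_nonneg_right hd (Real.sqrt_nonneg (‖x‖ * ‖y‖))).trans hk
    refine le_of_mul_le_mul_left ?_ h1
    linarith
  · positivity

theorem inv_le_menger {s t : ℝ} (hs : 0 < s) (hst : s < t) :
    t⁻¹ ≤ menger (pt s 0) (pt t 0) (pt 0 t) := by
  have ht := hs.trans hst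
  have hline : ∀ w ∈ affineSpan ℝ ({pt s 0, pt t 0} : Set (EuclideanSpace ℝ (Fin 2))),
      w 1 = 0 := by
    intro w hw
    obtain ⟨r, rfl⟩ := mem_affineSpan_pair_iff_exists_lineMap_eq.1 hw
    simp [AffineMap.lineMap_apply, pt_apply_one]
  have h01 : pt s 0 ≠ pt t 0 := fun h => hst.ne (isometry_pt_left.injective h)
  have h02 : pt s 0 ≠ pt 0 t := fun h => ht.ne (by
    simpa [pt_apply_one] using congrArg (fun w : EuclideanSpace ℝ (Fin 2) => w 1) h)
  have h12 : pt t 0 ≠ pt 0 t := fun h => ht.ne (by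
    simpa [pt_apply_one] using congrArg (fun w : EuclideanSpace ℝ (Fin 2) => w 1) h)
  have hcol : ¬ Collinear ℝ ({pt s 0, pt t 0, pt 0 t} : Set (EuclideanSpace ℝ (Fin 2))) := by
    intro h
    have := hline _ (h.mem_affineSpan_of_mem_of_ne (p₁ := pt s 0) (p₂ := pt t 0) (p₃ := pt 0 t)
      (by simp) (by simp) (by simp) h01)
    rw [pt_apply_one] at this
    exact ht.ne' this
  rw [menger, if_pos ⟨h01, h12, h02, hcol⟩]
  have hinf : t ≤ Metric.infDist (pt 0 t)
      (affineSpan ℝ ({pt s 0, pt t 0} : Set (EuclideanSpace ℝ (Fin 2))) :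
        Set (EuclideanSpace ℝ (Fin 2))) := by
    rw [Metric.le_infDist ⟨pt s 0, left_mem_affineSpan_pair ℝ _ _⟩]
    intro w hw
    rw [dist_plane_eq, hline w hw, pt_apply_one]
    apply Real.le_sqrt_of_sq_le
    nlinarith [sq_nonneg (pt 0 t 0 - w 0)]
  have hprod : dist (pt s 0) (pt 0 t) * dist (pt t 0) (pt 0 t) ≤ 2 * t ^ 2 := by
    rw [dist_plane_eq, dist_plane_eq, ← Real.sqrt_mul (by positivity)]
    simp only [pt_apply_zero, pt_apply_one]
    apply Real.sqrt_le_iff.2 ⟨by positivity, ?_⟩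
    nlinarith [mul_nonneg (sq_nonneg t) (show (0 : ℝ) ≤ t ^ 2 - s ^ 2 by nlinarith)]
  have hpos : 0 < dist (pt s 0) (pt 0 t) * dist (pt t 0) (pt 0 t) :=
    mul_pos (dist_pos.2 h02) (dist_pos.2 h12)
  rw [inv_eq_one_div, div_le_div_iff₀ ht hpos]
  nlinarith

theorem setLIntegral_Eset_norm_rpow_lt_top {q : ℝ} (hq : -1 < q) :
    ∫⁻ x in Eset (π / 2), ENNReal.ofReal (‖x‖ ^ q) ∂μH[1] < ⊤ := by
  have h : ∫⁻ t in Set.Ico (0 : ℝ) 1, ENNReal.ofReal (t ^ q) < ⊤ := by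
    rw [setLIntegral_congr Ioo_ae_eq_Ico.symm]
    exact ((intervalIntegral.integrableOn_Ioo_rpow_iff one_pos).2 hq).setLIntegral_lt_top
  rw [Eset_pi_div_two]
  refine (lintegral_union_le _ _ _).trans_lt (ENNReal.add_lt_top.2 ⟨?_, ?_⟩)
  · rw [isometry_pt_left.setLIntegral_image_hausdorffMeasure measurableSet_Ico]
    refine lt_of_eq_of_lt (setLIntegral_congr_fun measurableSet_Ico fun t ht => ?_) h
    simp only [norm_pt_left ht.1]
  · rw [isometry_pt_right.setLIntegral_image_hausdorffMeasure measurableSet_Ico]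
    refine lt_of_eq_of_lt (setLIntegral_congr_fun measurableSet_Ico fun t ht => ?_) h
    simp only [norm_pt_right ht.1]

theorem iSup_menger_rpow_le {p : ℝ} (hp : 0 < p) {x y : EuclideanSpace ℝ (Fin 2)}
    (hx : x ∈ Eset (π / 2)) (hy : y ∈ Eset (π / 2)) (hx0 : x ≠ 0) (hy0 : y ≠ 0) :
    (⨆ z ∈ Eset (π / 2), ENNReal.ofReal (menger x y z)) ^ p ≤
      ENNReal.ofReal (2 ^ p) * ENNReal.ofReal (‖y‖ ^ (-(p / 2))) *
        ENNReal.ofReal (‖x‖ ^ (-(p / 2))) := by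
  have hx1 := norm_pos_iff.2 hx0
  have hy1 := norm_pos_iff.2 hy0
  have h : (2 / √(‖x‖ * ‖y‖)) ^ p = 2 ^ p * ‖y‖ ^ (-(p / 2)) * ‖x‖ ^ (-(p / 2)) := by
    rw [Real.div_rpow zero_le_two (Real.sqrt_nonneg _), Real.sqrt_eq_rpow,
      ← Real.rpow_mul (by positivity), Real.mul_rpow hx1.le hy1.le, Real.rpow_neg hx1.le,
      Real.rpow_neg hy1.le, show 1 / 2 * p = p / 2 by ring]
    field_simp
  rw [← ENNReal.ofReal_mul (by positivity), ← ENNReal.ofReal_mul (by positivity), ← h,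
    ← ENNReal.ofReal_rpow_of_pos (by positivity)]
  refine ENNReal.rpow_le_rpow (iSup₂_le fun z hz => ?_) hp.le
  exact ENNReal.ofReal_le_ofReal (menger_le_of_mem_Eset hx hy hz hx0 hy0)

theorem Ip_Eset_pi_div_two_lt_top {p : ℝ} (hp : 0 < p) (hp2 : p < 2) :
    Ip p (Eset (π / 2)) < ⊤ := by
  have hae : ∀ᵐ x ∂(μH[1] : Measure (EuclideanSpace ℝ (Fin 2))).restrict (Eset (π / 2)),
      x ∈ Eset (π / 2) ∧ x ≠ 0 := by
    have := Measure.nullSingletonClass_hausdorff (EuclideanSpace ℝ (Fin 2)) one_pos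
    exact (ae_restrict_mem measurableSet_Eset_pi_div_two).and (Measure.ae_ne _ 0)
  have hm : Measurable fun x : EuclideanSpace ℝ (Fin 2) => ENNReal.ofReal (‖x‖ ^ (-(p / 2))) := by
    fun_prop
  have hfin := setLIntegral_Eset_norm_rpow_lt_top (q := -(p / 2)) (by linarith)
  calc Ip p (Eset (π / 2))
      ≤ ∫⁻ y in Eset (π / 2), ∫⁻ x in Eset (π / 2),
          ENNReal.ofReal (2 ^ p) * ENNReal.ofReal (‖y‖ ^ (-(p / 2))) *
            ENNReal.ofReal (‖x‖ ^ (-(p / 2))) ∂μH[1] ∂μH[1] := by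
        refine lintegral_mono_ae ?_
        filter_upwards [hae] with y hy
        refine lintegral_mono_ae ?_
        filter_upwards [hae] with x hx
        exact iSup_menger_rpow_le hp hx.1 hy.1 hx.2 hy.2
    _ = ENNReal.ofReal (2 ^ p) *
          (∫⁻ y in Eset (π / 2), ENNReal.ofReal (‖y‖ ^ (-(p / 2))) ∂μH[1]) *
          ∫⁻ x in Eset (π / 2), ENNReal.ofReal (‖x‖ ^ (-(p / 2))) ∂μH[1] := by
        simp_rw [lintegral_const_mul _ hm]
        rw [lintegral_mul_const _ (hm.const_mul _), lintegral_const_mul _ hm]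
    _ < ⊤ := ENNReal.mul_lt_top (ENNReal.mul_lt_top ENNReal.ofReal_lt_top hfin) hfin

theorem lintegral_Ioo_inv_eq_top : ∫⁻ t in Set.Ioo (0 : ℝ) 1, ENNReal.ofReal t⁻¹ = ⊤ := by
  by_contra h
  have hi : IntegrableOn (fun t : ℝ => t ^ (-1 : ℝ)) (Set.Ioo 0 1) := by
    simp_rw [Real.rpow_neg_one]
    refine ⟨measurable_inv.aestronglyMeasurable, ?_⟩
    rw [hasFiniteIntegral_iff_ofReal]
    · exact lt_top_iff_ne_top.2 h
    · filter_upwards [ae_restrict_mem measurableSet_Ioo] with t ht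
      exact inv_nonneg.2 ht.1.le
  exact lt_irrefl _ ((intervalIntegral.integrableOn_Ioo_rpow_iff one_pos).1 hi)

theorem Ip_Eset_pi_div_two_eq_top {p : ℝ} (hp : 2 ≤ p) : Ip p (Eset (π / 2)) = ⊤ := by
  have hsub {t : ℝ} (ht : t ≤ 1) : (fun t : ℝ => pt t 0) '' Set.Ioo 0 t ⊆ Eset (π / 2) := by
    rw [Eset_pi_div_two]
    rintro _ ⟨s, hs, rfl⟩
    exact Or.inl ⟨s, ⟨hs.1.le, hs.2.trans_le ht⟩, rfl⟩
  rw [← top_le_iff, ← lintegral_Ioo_inv_eq_top]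
  refine le_trans ?_ (lintegral_mono_set (hsub le_rfl))
  rw [isometry_pt_left.setLIntegral_image_hausdorffMeasure measurableSet_Ioo]
  refine setLIntegral_mono' measurableSet_Ioo fun t ht => ?_
  refine le_trans ?_ (lintegral_mono_set (hsub ht.2.le))
  rw [isometry_pt_left.setLIntegral_image_hausdorffMeasure measurableSet_Ioo]
  have hz : pt 0 t ∈ Eset (π / 2) := by
    rw [Eset_pi_div_two]
    exact Or.inr ⟨t, ⟨ht.1.le, ht.2⟩, rfl⟩
  calc ENNReal.ofReal t⁻¹ ≤ ENNReal.ofReal (t⁻¹ ^ p * t) := by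
        apply ENNReal.ofReal_le_ofReal
        have h1 : 1 ≤ t⁻¹ := (one_le_inv₀ ht.1).2 ht.2.le
        have h2 : t⁻¹ ^ (2 : ℝ) ≤ t⁻¹ ^ p := Real.rpow_le_rpow_of_exponent_le h1 hp
        rw [Real.rpow_two] at h2
        have h3 : t⁻¹ = t⁻¹ ^ 2 * t := by have := ht.1; field_simp
        rw [h3]
        simpa only [← h3] using mul_le_mul_of_nonneg_right h2 ht.1.le
    _ = ∫⁻ _ in Set.Ioo 0 t, ENNReal.ofReal t⁻¹ ^ p := by
        rw [setLIntegral_const, Real.volume_Ioo, sub_zero,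
          ENNReal.ofReal_rpow_of_pos (inv_pos.2 ht.1),
          ENNReal.ofReal_mul (Real.rpow_nonneg (inv_nonneg.2 ht.1.le) _)]
    _ ≤ _ := by
        refine setLIntegral_mono' measurableSet_Ioo fun s hs => ?_
        refine ENNReal.rpow_le_rpow ?_ (by linarith)
        exact (ENNReal.ofReal_le_ofReal (inv_le_menger hs.1 hs.2)).trans
          (le_iSup₂_of_le (pt 0 t) hz le_rfl)

/-- `I_p(E_{π/2}) < ∞` if and only if `p ∈ (0,2)`. -/
theorem Ip_Eset_pi_div_two_lt_top_iff (p : ℝ) (hp : 0 < p) :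
    Ip p (Eset (π / 2)) < ⊤ ↔ p ∈ Set.Ioo (0:ℝ) 2 := by
  refine ⟨fun h => ⟨hp, ?_⟩, fun h => Ip_Eset_pi_div_two_lt_top h.1 h.2⟩
  by_contra! h2
  exact h.ne (Ip_Eset_pi_div_two_eq_top h2)
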